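/- Let X be a Peano space whose maximal cyclic subsets are compact surfaces. If C_1, C_2 ⊂ X are admissible subcontinua whose intersection consists of exactly one point, then C_1 ∪ C_2 is an admissible subcontinuum of X. -/

import Mathlib

open Filter Topology Metric Set GromovHausdorff
open scoped ENNReal unitInterval

noncomputable section

/-! ## Model spaces -/

/-- The closed upper half plane in `ℝ × ℝ` (used for topological charts). -/
def HalfPlane : Set (ℝ × ℝ) := {p | 0 ≤ p.2}

/-- The closed upper half plane in the Euclidean plane (used for metric charts). -/
def EHalfPlane : Set (EuclideanSpace ℝ (Fin 2)) := {p | 0 ≤ p 1}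

/-- The unit circle (the 1-sphere). -/
def Circle1 : Set (EuclideanSpace ℝ (Fin 2)) := Metric.sphere 0 1

/-- The 2-sphere. -/
def Sphere2 : Set (EuclideanSpace ℝ (Fin 3)) := Metric.sphere 0 1

/-- The closed 2-disc. -/
def Disc2 : Set (EuclideanSpace ℝ (Fin 2)) := Metric.closedBall 0 1

/-- The relation on the unit square generating the Möbius identification
`(0, y) ∼ (1, 1 - y)`. -/
def mobiusRel (p q : I × I) : Prop :=
  ((p.1 : ℝ) = 0 ∧ (q.1 : ℝ) = 1 ∧ (p.2 : ℝ) = 1 - (q.2 : ℝ)) ∨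
  ((p.1 : ℝ) = 1 ∧ (q.1 : ℝ) = 0 ∧ (p.2 : ℝ) = 1 - (q.2 : ℝ))

/-- The Möbius band, as a quotient of the unit square. -/
def MobiusBand : Type := Quot mobiusRel

instance : TopologicalSpace MobiusBand :=
  inferInstanceAs (TopologicalSpace (Quot mobiusRel))

/-! ## Surfaces -/

/-- A topological 2-manifold with (possibly empty) boundary: every point has an open
neighborhood homeomorphic to an open subset of the closed half plane. -/
def IsSurface (X : Type*) [TopologicalSpace X] : Prop :=
  ∀ x : X, ∃ (U : Set X) (V : Set HalfPlane),
    IsOpen U ∧ x ∈ U ∧ IsOpen V ∧ Nonempty (↥U ≃ₜ ↥V)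

/-- A compact surface: a compact connected (Hausdorff) topological 2-manifold with
possibly empty boundary. -/
def IsCompactSurface (X : Type*) [TopologicalSpace X] : Prop :=
  CompactSpace X ∧ ConnectedSpace X ∧ T2Space X ∧ IsSurface X

/-- The (manifold) boundary of a surface: the set of points having no open neighborhood
homeomorphic to an open subset of the plane. -/
def surfaceBoundary (X : Type*) [TopologicalSpace X] : Set X :=
  {x | ¬ ∃ (U : Set X) (V : Set (ℝ × ℝ)), IsOpen U ∧ x ∈ U ∧ IsOpen V ∧ Nonempty (↥U ≃ₜ ↥V)}

/-- The set of boundary components of a surface, i.e. the connected components of the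
boundary. -/
def surfaceBoundaryComponents (X : Type*) [TopologicalSpace X] : Set (Set X) :=
  {b | ∃ x ∈ surfaceBoundary X, b = connectedComponentIn (surfaceBoundary X) x}

/-- A surface is orientable iff it contains no subset homeomorphic to the Möbius band. -/
def SurfOrientable (X : Type*) [TopologicalSpace X] : Prop :=
  ¬ ∃ A : Set X, Nonempty (↥A ≃ₜ MobiusBand)

/-- The free rank of the first homology (the abelianized fundamental group). -/
noncomputable def h1Rank (X : Type*) [TopologicalSpace X] : ℕ :=
  ⨆ x : X, (Module.rank ℤ (Additive (Abelianization (FundamentalGroup X x)))).toNat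

open Classical in
/-- The connectivity number of a compact surface `S`, i.e. `2 - χ(S)`.  By the
classification of compact surfaces this equals the free rank of the first homology,
plus one unless the surface is closed and orientable. -/
noncomputable def connNum (X : Type*) [TopologicalSpace X] : ℕ :=
  h1Rank X + (if surfaceBoundary X = ∅ ∧ SurfOrientable X then 0 else 1)

/-- The reduced connectivity number: the connectivity number minus the number of
boundary components. -/
noncomputable def redConnNum (X : Type*) [TopologicalSpace X] : ℤ :=
  (connNum X : ℤ) - ((surfaceBoundaryComponents X).ncard : ℤ)

/-! ## Length and geodesic spaces -/

/-- The length of a path, as the total variation of the parametrization. -/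
noncomputable def pathLength {X : Type*} [MetricSpace X] {x y : X} (γ : Path x y) : ℝ≥0∞ :=
  eVariationOn (fun t => γ t) Set.univ

/-- A metric space is a length space if the distance between any two points is the
infimum of the lengths of paths joining them. -/
def IsLengthSpace (X : Type*) [MetricSpace X] : Prop :=
  ∀ x y : X, edist x y = ⨅ γ : Path x y, pathLength γ

/-- A metric space is geodesic if any two points are joined by a path whose length
realizes the distance. -/
def IsGeodesicSpace (X : Type*) [MetricSpace X] : Prop :=
  ∀ x y : X, ∃ γ : Path x y, pathLength γ = edist x y

/-! ## Peano spaces, Jordan curves and cyclic elements -/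

/-- A Peano space: a compact connected locally connected metric space. -/
def IsPeano (X : Type*) [MetricSpace X] : Prop :=
  CompactSpace X ∧ ConnectedSpace X ∧ LocallyConnectedSpace X

/-- A Jordan curve: a subset homeomorphic to the 1-sphere. -/
def IsJordanCurve {X : Type*} [TopologicalSpace X] (J : Set X) : Prop :=
  Nonempty (↥J ≃ₜ ↥Circle1)

/-- A set is cyclicly connected if every pair of distinct points of it lies on a common
Jordan curve contained in it. -/
def CycliclyConnected {X : Type*} [TopologicalSpace X] (A : Set X) : Prop :=
  ∀ x ∈ A, ∀ y ∈ A, x ≠ y → ∃ J : Set X, J ⊆ A ∧ IsJordanCurve J ∧ x ∈ J ∧ y ∈ J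

/-- A maximal cyclic subset: a nondegenerate cyclicly connected subset which is not a
proper subset of any cyclicly connected subset. -/
def IsMaximalCyclic {X : Type*} [TopologicalSpace X] (A : Set X) : Prop :=
  A.Nontrivial ∧ CycliclyConnected A ∧ ∀ B : Set X, CycliclyConnected B → A ⊆ B → A = B

/-- A subcontinuum: a compact connected (hence nonempty) subset. -/
def IsSubcontinuum {X : Type*} [TopologicalSpace X] (C : Set X) : Prop :=
  IsCompact C ∧ IsConnected C

/-- `b` is a boundary component of the subset `T` (viewed as a subspace). -/
def IsBoundaryComponentOf {X : Type*} [TopologicalSpace X] (T b : Set X) : Prop :=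
  ∃ b' ∈ surfaceBoundaryComponents ↥T, b = Subtype.val '' b'

/-- An admissible subcontinuum: it meets every maximal cyclic subset `T` in at most a
point or in a boundary component of `T`. -/
def IsAdmissible {X : Type*} [TopologicalSpace X] (C : Set X) : Prop :=
  IsSubcontinuum C ∧
    ∀ T : Set X, IsMaximalCyclic T →
      ((T ∩ C).Subsingleton ∨ IsBoundaryComponentOf T (T ∩ C))

/-- A 1-cactoid: a Peano space all of whose maximal cyclic subsets are homeomorphic to
the 1-sphere. -/
def IsOneCactoid (X : Type*) [MetricSpace X] : Prop :=
  IsPeano X ∧ ∀ T : Set X, IsMaximalCyclic T → Nonempty (↥T ≃ₜ ↥Circle1)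

/-- A subset homeomorphic to the 2-sphere or the closed 2-disc. -/
def SphereOrDisc {X : Type*} [TopologicalSpace X] (T : Set X) : Prop :=
  Nonempty (↥T ≃ₜ ↥Sphere2) ∨ Nonempty (↥T ≃ₜ ↥Disc2)

/-! ## Generalized cactoids -/

/-- A generalized cactoid. -/
def IsGeneralizedCactoid (X : Type*) [MetricSpace X] : Prop :=
  IsPeano X ∧ (∀ T : Set X, IsMaximalCyclic T → IsCompactSurface ↥T) ∧
  {T : Set X | IsMaximalCyclic T ∧ ¬ SphereOrDisc T}.Finite ∧
  ∃ (n : ℕ) (C : Fin n → Set X),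
    (∀ i, IsAdmissible (C i)) ∧ (Pairwise fun i j => Disjoint (C i) (C j)) ∧
    ∀ T b : Set X, IsMaximalCyclic T → IsBoundaryComponentOf T b → b ⊆ ⋃ i, C i

/-- A pre-boundary consisting of `n` disjoint admissible subcontinua, each containing a
boundary component of some maximal cyclic subset, which together cover all boundary
components of all maximal cyclic subsets. -/
def IsPreBoundaryOfSize {X : Type*} [TopologicalSpace X] (n : ℕ) (P : Set X) : Prop :=
  ∃ C : Fin n → Set X,
    (∀ i, IsAdmissible (C i)) ∧ (Pairwise fun i j => Disjoint (C i) (C j)) ∧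
    (∀ i, ∃ T b : Set X, IsMaximalCyclic T ∧ IsBoundaryComponentOf T b ∧ b ⊆ C i) ∧
    (∀ T b : Set X, IsMaximalCyclic T → IsBoundaryComponentOf T b → b ⊆ ⋃ i, C i) ∧
    P = ⋃ i, C i

def IsPreBoundary {X : Type*} [TopologicalSpace X] (P : Set X) : Prop :=
  ∃ n, IsPreBoundaryOfSize n P

/-- A minimal pre-boundary: one with the minimal possible number of pieces. -/
def IsMinimalPreBoundary {X : Type*} [TopologicalSpace X] (P : Set X) : Prop :=
  ∃ n, IsPreBoundaryOfSize n P ∧ ∀ (m : ℕ) (Q : Set X), IsPreBoundaryOfSize m Q → n ≤ m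

/-- The boundary of a generalized cactoid: the union of all minimal pre-boundaries. -/
def cactoidBoundary (X : Type*) [TopologicalSpace X] : Set X :=
  ⋃₀ {P : Set X | IsMinimalPreBoundary P}

/-- The boundary components of a generalized cactoid: the connected components of its
boundary. -/
def cactoidBoundaryComponents (X : Type*) [TopologicalSpace X] : Set (Set X) :=
  {b | ∃ x ∈ cactoidBoundary X, b = connectedComponentIn (cactoidBoundary X) x}

/-- The connectivity number of a generalized cactoid: the sum of the reduced
connectivity numbers of its maximal cyclic subsets plus the number of its boundary
components. -/
noncomputable def cactoidConnNum (X : Type*) [TopologicalSpace X] : ℤ :=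
  (∑ᶠ T ∈ {T : Set X | IsMaximalCyclic T}, redConnNum ↥T) +
    ((cactoidBoundaryComponents X).ncard : ℤ)

/-! ## Bundled spaces -/

structure BundledMet where
  carrier : Type
  [str : MetricSpace carrier]

attribute [instance] BundledMet.str

structure BundledTop where
  carrier : Type
  [str : TopologicalSpace carrier]

attribute [instance] BundledTop.str

/-! ## Metric two-point identifications -/

/-- `p : A → B` is (the projection of) a metric 2-point identification: it glues exactly
two distinct points `x₁, x₂` of `A` and carries the corresponding quotient metric. -/
def IsTwoPointIdentification {A B : Type*} [MetricSpace A] [MetricSpace B] (p : A → B) : Prop :=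
  Function.Surjective p ∧ ∃ x₁ x₂ : A, x₁ ≠ x₂ ∧
    (∀ a b : A, p a = p b ↔ (a = b ∨ (a = x₁ ∧ b = x₂) ∨ (a = x₂ ∧ b = x₁))) ∧
    ∀ a b : A, dist (p a) (p b) =
      min (dist a b) (min (dist a x₁ + dist x₂ b) (dist a x₂ + dist x₁ b))

/-- `Y` is obtained from `X` by a successive application of `k` metric 2-point
identifications, exactly `k₀` of which are boundary identifications with respect to the
subset `B ⊆ X`. -/
def ObtainedByIdentifications (X : Type) [MetricSpace X] (B : Set X) (k k0 : ℕ)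
    (Y : Type) [MetricSpace Y] : Prop :=
  ∃ (Z : ℕ → BundledMet) (p : ∀ i : ℕ, (Z i).carrier → (Z (i + 1)).carrier)
    (e : X ≃ᵢ (Z 0).carrier) (f : (Z k).carrier ≃ᵢ Y) (q : ∀ i : ℕ, X → (Z i).carrier),
    (∀ i, i < k → IsTwoPointIdentification (p i)) ∧
    (∀ x, q 0 x = e x) ∧ (∀ i x, q (i + 1) x = p i (q i x)) ∧
    {i : ℕ | i < k ∧ ∃ a b : (Z i).carrier,
        a ∈ q i '' B ∧ b ∈ q i '' B ∧ a ≠ b ∧ p i a = p i b}.ncard = k0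

/-! ## Gromov–Hausdorff sequences of surfaces -/

/-- A sequence of (isometry classes of) compact length surfaces with connectivity
number `c`. -/
def IsSurfaceGHSeq (c : ℕ) (K : ℕ → GHSpace) : Prop :=
  ∀ n, IsCompactSurface (K n).Rep ∧ IsLengthSpace (K n).Rep ∧ connNum (K n).Rep = c

/-- The structural description of the limit spaces in the Main Theorem: `X` is obtained
from a geodesic generalized cactoid `Y` by `k` successive metric 2-point
identifications, `k₀` of them boundary identifications, where the connectivity number
of `Y` is at most `c + k₀ - 2k`. -/
def MainThmRHS (c : ℕ) (X : Type) [MetricSpace X] : Prop :=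
  ∃ (k k0 : ℕ) (Y : BundledMet),
    IsGeneralizedCactoid Y.carrier ∧ IsGeodesicSpace Y.carrier ∧
    ObtainedByIdentifications Y.carrier (cactoidBoundary Y.carrier) k k0 X ∧
    cactoidConnNum Y.carrier ≤ (c : ℤ) + (k0 : ℤ) - 2 * (k : ℤ)

/-! ## Covering dimension -/

/-- `X` has covering dimension at most `n`: every open cover admits an open refinement
of order at most `n + 1`. -/
def CoveringDimLE (X : Type*) [TopologicalSpace X] (n : ℕ) : Prop :=
  ∀ U : Set (Set X), (∀ u ∈ U, IsOpen u) → ⋃₀ U = Set.univ →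
    ∃ V : Set (Set X), (∀ v ∈ V, IsOpen v) ∧ ⋃₀ V = Set.univ ∧
      (∀ v ∈ V, ∃ u ∈ U, v ⊆ u) ∧
      ∀ x : X, {v | v ∈ V ∧ x ∈ v}.encard ≤ (n : ℕ∞) + 1

/-! ## Curves in surfaces -/

/-- A continuous map from the circle is nullhomotopic if it is homotopic to a constant. -/
def IsNullhomotopic {X : Type*} [TopologicalSpace X] (f : C(↥Circle1, X)) : Prop :=
  ∃ y : X, f.Homotopic (ContinuousMap.const _ y)

/-- A contractible Jordan curve. -/
def IsContractibleJordanCurve {X : Type*} [TopologicalSpace X] (J : Set X) : Prop :=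
  IsJordanCurve J ∧
    ∀ f : C(↥Circle1, X), Function.Injective f → Set.range f = J → IsNullhomotopic f

/-- A non-contractible Jordan curve. -/
def IsNonContractibleJordanCurve {X : Type*} [TopologicalSpace X] (J : Set X) : Prop :=
  IsJordanCurve J ∧
    ∀ f : C(↥Circle1, X), Function.Injective f → Set.range f = J → ¬ IsNullhomotopic f

/-- A simple arc in a surface: an injective path whose endpoints lie on the boundary and
whose interior does not. -/
def IsSimpleArc {X : Type*} [TopologicalSpace X] (γ : C(I, X)) : Prop :=
  Function.Injective γ ∧ γ 0 ∈ surfaceBoundary X ∧ γ 1 ∈ surfaceBoundary X ∧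
    ∀ t : I, t ≠ 0 → t ≠ 1 → γ t ∉ surfaceBoundary X

/-- A subset separates the space if its complement is disconnected. -/
def SeparatesSpace {X : Type*} [TopologicalSpace X] (A : Set X) : Prop :=
  ¬ IsPreconnected Aᶜ

/-- The arc `γ` forms a contractible Jordan curve together with a subarc of some
boundary component. -/
def FormsContractibleJordanWithBoundary {X : Type*} [TopologicalSpace X]
    (γ : C(I, X)) : Prop :=
  ∃ β : C(I, X), Function.Injective β ∧ Set.range β ⊆ surfaceBoundary X ∧
    β 0 = γ 0 ∧ β 1 = γ 1 ∧ IsContractibleJordanCurve (Set.range γ ∪ Set.range β)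

/-- `z` separates `x` and `y` inside the subset `A`: both lie in `A \ {z}` and no
connected subset of `A \ {z}` contains both. -/
def SeparatesIn {X : Type*} [TopologicalSpace X] (A : Set X) (z x y : X) : Prop :=
  x ∈ A \ {z} ∧ y ∈ A \ {z} ∧
    ∀ C : Set X, C ⊆ A \ {z} → IsPreconnected C → ¬ (x ∈ C ∧ y ∈ C)

/-! ## Metric doubles -/

/-- `D` together with the two canonical maps `ip, im : X → D` is the metric double of
`X` along the subset `B`. -/
structure IsMetricDouble (X : Type*) [MetricSpace X] (B : Set X) (D : Type*)
    [MetricSpace D] (ip im : X → D) : Prop where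
  isom_p : Isometry ip
  isom_m : Isometry im
  surj : Set.range ip ∪ Set.range im = Set.univ
  agree : ∀ z ∈ B, ip z = im z
  dist_mix : ∀ a b : X, dist (ip a) (im b) = ⨅ z : ↥B, (dist a (z : X) + dist (z : X) b)

/-- Regularity of a sequence of doubles: there is no sequence of non-contractible
Jordan curves in the doubles with vanishing diameters. -/
def RegularDoubleSeq (D : ℕ → Type) [∀ n, MetricSpace (D n)] : Prop :=
  ∀ J : ∀ n, Set (D n), (∀ n, IsNonContractibleJordanCurve (J n)) →
    0 < ⨅ n, Metric.diam (J n)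

/-- The copy `A^+` (or `A^-`) in the double limit corresponding to a subset `A` of the
limit `X`, via the isometric identification `j` of `X` with `X^+` (resp. `X^-`). -/
def plusCopy {Z D : Type*} {X : Set Z} {Xp : Set D} (j : ↥X → ↥Xp) (A : Set Z) :
    Set D :=
  (fun x => ((j x : ↥Xp) : D)) '' {x : ↥X | (x : Z) ∈ A}

/-! ## Riemannian and polyhedral surfaces -/

/-- The Riemannian length integrand `√(g_{γ(t)}(γ'(t), γ'(t)))`. -/
noncomputable def riemLengthIntegrand (g : (ℝ × ℝ) → (ℝ × ℝ) → (ℝ × ℝ) → ℝ)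
    (γ : ℝ → ℝ × ℝ) (t : ℝ) : ℝ :=
  Real.sqrt (g (γ t) (deriv γ t) (deriv γ t))

/-- A compact connected smooth Riemannian 2-manifold, as a metric space: a compact
length surface such that around every point there is a chart in which the length of
every C¹ curve is computed by a smooth positive definite symmetric bilinear metric. -/
def IsSmoothRiemannianSurface (X : Type*) [MetricSpace X] : Prop :=
  IsCompactSurface X ∧ IsLengthSpace X ∧
  ∀ x : X, ∃ (U : Set X) (V : Set (ℝ × ℝ)) (φ : X → ℝ × ℝ) (ψ : ℝ × ℝ → X)
      (g : (ℝ × ℝ) → (ℝ × ℝ) → (ℝ × ℝ) → ℝ),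
    IsOpen U ∧ x ∈ U ∧ (∃ V' : Set (ℝ × ℝ), IsOpen V' ∧ V = V' ∩ HalfPlane) ∧
    ContinuousOn φ U ∧ φ '' U = V ∧ ContinuousOn ψ V ∧
    (∀ y ∈ U, ψ (φ y) = y) ∧ (∀ v ∈ V, φ (ψ v) = v) ∧
    (∀ m : ℕ, ContDiffOn ℝ m
      (fun pq : (ℝ × ℝ) × (ℝ × ℝ) × (ℝ × ℝ) => g pq.1 pq.2.1 pq.2.2)
      (V ×ˢ ((Set.univ : Set (ℝ × ℝ)) ×ˢ (Set.univ : Set (ℝ × ℝ))))) ∧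
    (∀ p u v, g p u v = g p v u) ∧
    (∀ p (a : ℝ) u u' v, g p (a • u + u') v = a * g p u v + g p u' v) ∧
    (∀ p ∈ V, ∀ u : ℝ × ℝ, u ≠ 0 → 0 < g p u u) ∧
    ∀ (cur : ℝ → X) (a b : ℝ), a ≤ b → Set.MapsTo cur (Set.Icc a b) U →
      ContDiffOn ℝ 1 (φ ∘ cur) (Set.Icc a b) →
      eVariationOn cur (Set.Icc a b) =
        ENNReal.ofReal (∫ t in a..b, riemLengthIntegrand g (φ ∘ cur) t)

/-- A polyhedral surface: a compact length surface which is flat (locally isometric to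
a subset of the Euclidean half plane) away from finitely many singular points. -/
def IsPolyhedralSurface (X : Type*) [MetricSpace X] : Prop :=
  IsCompactSurface X ∧ IsLengthSpace X ∧
  ∃ F : Set X, F.Finite ∧ ∀ x : X, x ∉ F →
    ∃ (U : Set X) (W : Set (EuclideanSpace ℝ (Fin 2))),
      IsOpen U ∧ x ∈ U ∧ W ⊆ EHalfPlane ∧ Nonempty (↥U ≃ᵢ ↥W)

end

/-! ## Paths in locally connected complete metric spaces -/

/-- An eventually constant sequence of points, consecutive ones lying in a common link. -/
structure LinkedChain (X : Type*) where
  vertex : ℕ → X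
  link : ℕ → Set X
  length : ℕ

/-- The chain ends at `y`, and its links are open, connected and of diameter at most `ε`. -/
structure LinkedChain.IsFine {X : Type*} [MetricSpace X] (s : LinkedChain X) (y : X) (ε : ℝ) :
    Prop where
  left_mem : ∀ j, s.vertex j ∈ s.link j
  right_mem : ∀ j, s.vertex (j + 1) ∈ s.link j
  isOpen : ∀ j, IsOpen (s.link j)
  isPreconnected : ∀ j, IsPreconnected (s.link j)
  dist_le : ∀ j, ∀ u ∈ s.link j, ∀ v ∈ s.link j, dist u v ≤ ε
  vertex_eq : ∀ j, s.length ≤ j → s.vertex j = y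

theorem exists_small_preconnected {X : Type*} [MetricSpace X] [LocallyConnectedSpace X]
    {V : Set X} (hV : IsOpen V) {x : X} (hx : x ∈ V) {ε : ℝ} (hε : 0 < ε) :
    ∃ W, W ⊆ V ∧ IsOpen W ∧ IsPreconnected W ∧ x ∈ W ∧ ∀ u ∈ W, ∀ v ∈ W, dist u v ≤ ε := by
  obtain ⟨W, hWsub, hWo, hxW, hWc⟩ := locallyConnectedSpace_iff_subsets_isOpen_isConnected.1
    ‹_› x (V ∩ ball x (ε / 2)) ((hV.inter isOpen_ball).mem_nhds ⟨hx, mem_ball_self (half_pos hε)⟩)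
  refine ⟨W, fun w hw => (hWsub hw).1, hWo, hWc.isPreconnected, hxW, fun u hu v hv => ?_⟩
  have h1 := mem_ball.1 (hWsub hu).2
  have h2 := mem_ball'.1 (hWsub hv).2
  linarith [dist_triangle u x v]

theorem exists_fine_chain {X : Type*} [MetricSpace X] [LocallyConnectedSpace X]
    {V : Set X} (hV : IsOpen V) (hVc : IsPreconnected V) {x y : X} (hx : x ∈ V) (hy : y ∈ V)
    {ε : ℝ} (hε : 0 < ε) :
    ∃ s : LinkedChain X, s.IsFine y ε ∧ s.vertex 0 = x ∧ (∀ j, s.link j ⊆ V) ∧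
      (x = y → s.length = 0) := by
  obtain ⟨W₀, hW₀V, hW₀o, hW₀c, hyW₀, hW₀ε⟩ := exists_small_preconnected hV hy hε
  by_cases hxy : x = y
  · subst hxy
    exact ⟨⟨fun _ => x, fun _ => W₀, 0⟩, ⟨fun _ => hyW₀, fun _ => hyW₀, fun _ => hW₀o,
      fun _ => hW₀c, fun _ => hW₀ε, fun _ _ => rfl⟩, rfl, fun _ => hW₀V, fun _ => rfl⟩
  simp only [hxy, false_imp_iff, and_true]
  let R : X → X → Prop := fun u v => ∃ W, W ⊆ V ∧ IsOpen W ∧ IsPreconnected W ∧ u ∈ W ∧ v ∈ W ∧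
    ∀ u ∈ W, ∀ v ∈ W, dist u v ≤ ε
  have hR : Relation.ReflTransGen R x y := by
    refine hVc.induction₂' _ (fun z hz => ?_) (fun _ _ _ _ _ _ h h' => h.trans h') hx hy
    obtain ⟨W, hWV, hWo, hWc, hzW, hWε⟩ := exists_small_preconnected hV hz hε
    filter_upwards [nhdsWithin_le_nhds (hWo.mem_nhds hzW)] with w hw
    exact ⟨.single ⟨W, hWV, hWo, hWc, hzW, hw, hWε⟩, .single ⟨W, hWV, hWo, hWc, hw, hzW, hWε⟩⟩
  clear hx hxy
  induction hR using Relation.ReflTransGen.head_induction_on with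
  | refl => exact ⟨⟨fun _ => y, fun _ => W₀, 0⟩, ⟨fun _ => hyW₀, fun _ => hyW₀, fun _ => hW₀o,
      fun _ => hW₀c, fun _ => hW₀ε, fun _ _ => rfl⟩, rfl, fun _ => hW₀V⟩
  | @head a c hac _ ih =>
    obtain ⟨s, hs, hs0, hsV⟩ := ih
    obtain ⟨W, hWV, hWo, hWc, haW, hcW, hWε⟩ := hac
    refine ⟨⟨fun j => j.casesOn a s.vertex, fun j => j.casesOn W s.link, s.length + 1⟩,
      ⟨?_, ?_, ?_, ?_, ?_, ?_⟩, rfl, ?_⟩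
    · rintro (_ | j); exacts [haW, hs.left_mem j]
    · rintro (_ | j); exacts [by simpa [hs0] using hcW, hs.right_mem j]
    · rintro (_ | j); exacts [hWo, hs.isOpen j]
    · rintro (_ | j); exacts [hWc, hs.isPreconnected j]
    · rintro (_ | j); exacts [hWε, hs.dist_le j]
    · rintro (_ | j) hj
      · exact absurd hj (by simp)
      · exact hs.vertex_eq j (by simpa using hj)
    · rintro (_ | j); exacts [hWV, hsV j]

theorem LinkedChain.IsFine.exists_refinement {X : Type*} [MetricSpace X] [LocallyConnectedSpace X]
    {s : LinkedChain X} {y : X} {ε δ : ℝ} (hs : s.IsFine y ε) (hδ : 0 < δ) :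
    ∃ (s' : LinkedChain X) (k : ℕ), s'.IsFine y δ ∧ 0 < k ∧ s'.length = k * s.length ∧
      s'.vertex 0 = s.vertex 0 ∧ ∀ i, s'.vertex i ∈ s.link (i / k) := by
  choose C hC hC0 hCV hCl using fun j => exists_fine_chain (hs.isOpen j) (hs.isPreconnected j)
    (hs.left_mem j) (hs.right_mem j) hδ
  let k := (Finset.range s.length).sup (fun j => (C j).length) + 1
  have hconst : ∀ j, s.length ≤ j → (C j).length = 0 := fun j hj =>
    hCl j (by rw [hs.vertex_eq j hj, hs.vertex_eq (j + 1) (by omega)])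
  have hlen : ∀ j, (C j).length ≤ k := by
    intro j
    rcases lt_or_ge j s.length with h | h
    · exact (Finset.le_sup (f := fun j => (C j).length) (Finset.mem_range.2 h)).trans
        (Nat.le_succ _)
    · simp [hconst j h]
  have hk : 0 < k := Nat.succ_pos _
  have hsucc : ∀ i, (C ((i + 1) / k)).vertex ((i + 1) % k) = (C (i / k)).vertex (i % k + 1) := by
    intro i
    rcases lt_or_ge (i % k + 1) k with h | h
    · have h1 : (i + 1) / k = i / k := by
        rw [Nat.div_eq_iff hk]
        have := Nat.div_add_mod i k
        constructor
        · rw [mul_comm]; omega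
        · rw [mul_comm]; omega
      have h2 : (i + 1) % k = i % k + 1 := by
        rw [Nat.add_mod, Nat.mod_eq_of_lt (show 1 < k by omega), Nat.mod_eq_of_lt h]
      rw [h1, h2]
    · have hr := Nat.mod_lt i hk
      have h0 : i + 1 = k * (i / k + 1) := by
        have := Nat.div_add_mod i k
        rw [mul_add]; omega
      have h1 : (i + 1) / k = i / k + 1 := by rw [h0, Nat.mul_div_cancel_left _ hk]
      have h2 : (i + 1) % k = 0 := by rw [h0, Nat.mul_mod_right]
      rw [h1, h2, hC0, (hC (i / k)).vertex_eq _ ((hlen _).trans h)]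
  refine ⟨⟨fun i => (C (i / k)).vertex (i % k), fun i => (C (i / k)).link (i % k), k * s.length⟩, k,
    ⟨fun i => (hC _).left_mem _, fun i => ?_, fun i => (hC _).isOpen _,
      fun i => (hC _).isPreconnected _, fun i => (hC _).dist_le _, fun i hi => ?_⟩, hk, rfl, ?_,
      fun i => hCV _ _ ((hC _).left_mem _)⟩
  · simpa only [hsucc] using (hC _).right_mem _
  · have hj : s.length ≤ i / k := (Nat.le_div_iff_mul_le hk).2 (by rw [mul_comm]; exact hi)
    change (C (i / k)).vertex (i % k) = y
    rw [(hC _).vertex_eq _ (by rw [hconst _ hj]; exact Nat.zero_le _)]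
    exact hs.vertex_eq _ (by omega)
  · simp [hC0]

theorem joinedIn_closedBall_of_small_preconnected {X : Type*} [MetricSpace X] [CompleteSpace X]
    [LocallyConnectedSpace X] {V : Set X} (hV : IsOpen V) (hVc : IsPreconnected V) {ε : ℝ}
    (hε : 0 < ε) (hdist : ∀ u ∈ V, ∀ v ∈ V, dist u v ≤ ε) {x y : X} (hx : x ∈ V) (hy : y ∈ V) :
    JoinedIn (closedBall x (3 * ε)) x y := by
  obtain ⟨W₀, -, hW₀o, hW₀c, hyW₀, hW₀ε⟩ := exists_small_preconnected hV hy hε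
  let s₀ : LinkedChain X :=
    ⟨fun j => if j = 0 then x else y, fun j => if j = 0 then V else W₀, 1⟩
  have hs₀ : s₀.IsFine y ε := by
    refine ⟨fun j => ?_, fun j => ?_, fun j => ?_, fun j => ?_, fun j => ?_, fun j hj => ?_⟩
    all_goals by_cases h : j = 0
    all_goals first | (simp [s₀, h]; assumption) | (simp [s₀, h] at hj ⊢)
  let S : ℕ → Type _ := fun n => {s : LinkedChain X // s.IsFine y (ε / 2 ^ n)}
  choose next k hfine hkpos hlen hv0 hmem using fun (n : ℕ) (s : S n) =>
    s.2.exists_refinement (show 0 < ε / 2 ^ (n + 1) by positivity)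
  let s : ∀ n, S n := fun n => Nat.rec ⟨s₀, by simpa using hs₀⟩ (fun n t => ⟨next n t, hfine n t⟩) n
  have hspos : ∀ n, 0 < (s n).1.length := by
    intro n
    induction n with
    | zero => exact Nat.one_pos
    | succ n ih =>
      change 0 < (next n (s n)).length
      rw [hlen]
      exact Nat.mul_pos (hkpos _ _) ih
  have hs0 : ∀ n, (s n).1.vertex 0 = x := by
    intro n
    induction n with
    | zero => simp [s, s₀]
    | succ n ih => exact (hv0 n (s n)).trans ih
  let f : ℕ → ℝ → X := fun n t => (s n).1.vertex ⌊t * (s n).1.length⌋₊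
  have hstep : ∀ t n, dist (f n t) (f (n + 1) t) ≤ (2 * ε) / 2 / 2 ^ n := by
    intro t n
    have hfl : ⌊t * (s (n + 1)).1.length⌋₊ / k n (s n) = ⌊t * (s n).1.length⌋₊ := by
      rw [← Nat.floor_div_natCast]
      congr 1
      have : (s (n + 1)).1.length = k n (s n) * (s n).1.length := hlen n (s n)
      have hk : (k n (s n) : ℝ) ≠ 0 := by exact_mod_cast (hkpos n (s n)).ne'
      rw [this]; push_cast; field_simp
    have h1 := hmem n (s n) ⌊t * (s (n + 1)).1.length⌋₊
    rw [hfl] at h1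
    have := (s n).2.dist_le _ _ ((s n).2.left_mem _) _ h1
    rw [mul_div_cancel_left₀ _ two_ne_zero]
    exact this
  choose g hg using fun t => cauchySeq_tendsto_of_complete
    (cauchySeq_of_le_geometric_two (hstep t))
  have hfg : ∀ n t, dist (f n t) (g t) ≤ 2 * ε / 2 ^ n := fun n t =>
    dist_le_of_le_geometric_two_of_tendsto (hstep t) (hg t) n
  have hnear : ∀ n (a b : ℝ), a ≤ b → b < a + 1 / (s n).1.length →
      dist (f n a) (f n b) ≤ ε / 2 ^ n := by
    intro n a b hab hb
    have hl : (0 : ℝ) < (s n).1.length := by exact_mod_cast hspos n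
    have h1 : ⌊a * (s n).1.length⌋₊ ≤ ⌊b * (s n).1.length⌋₊ := Nat.floor_mono (by gcongr)
    have h2 : ⌊b * (s n).1.length⌋₊ < ⌊a * (s n).1.length⌋₊ + 2 := by
      rw [Nat.floor_lt' (by omega)]
      have := Nat.lt_floor_add_one (a * (s n).1.length)
      have h3 : b * (s n).1.length < (a + 1 / (s n).1.length) * (s n).1.length := by gcongr
      rw [add_mul, one_div_mul_cancel hl.ne'] at h3
      push_cast; linarith
    rcases (show ⌊b * (s n).1.length⌋₊ = ⌊a * (s n).1.length⌋₊ ∨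
      ⌊b * (s n).1.length⌋₊ = ⌊a * (s n).1.length⌋₊ + 1 by omega) with h | h
    · simp only [f, h, dist_self]; positivity
    · simp only [f, h]
      exact (s n).2.dist_le _ _ ((s n).2.left_mem _) _ ((s n).2.right_mem _)
  have hcont : Continuous g := by
    rw [Metric.continuous_iff]
    intro a η hη
    obtain ⟨n, hn⟩ := exists_pow_lt_of_lt_one (show 0 < η / (5 * ε) by positivity)
      (show (1 / 2 : ℝ) < 1 by norm_num)
    have hn' : 5 * (ε / 2 ^ n) < η := by
      rw [lt_div_iff₀ (by positivity), one_div, inv_pow] at hn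
      calc 5 * (ε / 2 ^ n) = (2 ^ n)⁻¹ * (5 * ε) := by ring
        _ < η := hn
    refine ⟨1 / (s n).1.length, by have := hspos n; positivity, fun b hb => ?_⟩
    have hd : dist (f n b) (f n a) ≤ ε / 2 ^ n := by
      rw [Real.dist_eq, abs_lt] at hb
      rcases le_total a b with h | h
      · rw [dist_comm]; exact hnear n a b h (by linarith [hb.2])
      · exact hnear n b a h (by linarith [hb.1])
    have h1 := hfg n b
    have h2 := hfg n a
    have h3 := dist_triangle4 (g b) (f n b) (f n a) (g a)
    rw [dist_comm (g b) (f n b)] at h3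
    have : 2 * ε / 2 ^ n = 2 * (ε / 2 ^ n) := by ring
    linarith
  refine JoinedIn.ofLine hcont.continuousOn ?_ ?_ ?_
  · refine tendsto_nhds_unique (hg 0) ?_
    simp [f, hs0]
  · refine tendsto_nhds_unique (hg 1) ?_
    refine tendsto_const_nhds.congr fun n => ?_
    simp only [f, one_mul, Nat.floor_natCast]
    exact ((s n).2.vertex_eq _ le_rfl).symm
  · rintro _ ⟨t, -, rfl⟩
    have h1 := hfg 0 t
    have h2 : dist (f 0 t) x ≤ ε := by
      have : f 0 t = x ∨ f 0 t = y := by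
        change (if _ then x else y) = x ∨ (if _ then x else y) = y
        split_ifs <;> simp
      rcases this with h | h
      · rw [h, dist_self]; exact hε.le
      · rw [h]; exact hdist y hy x hx
    rw [mem_closedBall]
    have := dist_triangle (g t) (f 0 t) x
    rw [dist_comm (g t) (f 0 t)] at this
    simp only [pow_zero, div_one] at h1
    linarith

theorem locallyPathConnectedSpace_of_complete (X : Type*) [MetricSpace X] [CompleteSpace X]
    [LocallyConnectedSpace X] : LocallyPathConnectedSpace X := by
  rw [locallyPathConnectedSpace_iff_pathComponentIn_mem_nhds]
  intro x U hU hxU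
  obtain ⟨ε, hε, hball⟩ := nhds_basis_closedBall.mem_iff.1 (hU.mem_nhds hxU)
  obtain ⟨V, -, hVo, hVc, hxV, hVε⟩ :=
    exists_small_preconnected isOpen_univ (mem_univ x) (show 0 < ε / 3 by positivity)
  refine mem_of_superset (hVo.mem_nhds hxV) fun y hy => ?_
  refine (joinedIn_closedBall_of_small_preconnected hVo hVc (by positivity) hVε hxV hy).mono ?_
  rwa [mul_div_cancel₀ _ (three_ne_zero)]

/-! ## Extracting an arc from a path -/

/-- Closed subsets `S` of the unit interval containing the end points such that `f` takes the same
value at both ends of every gap of `S`. -/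
def gapClosedSets {X : Type*} (f : ℝ → X) : Set (Set ℝ) :=
  {S | IsClosed S ∧ S ⊆ Icc 0 1 ∧ 0 ∈ S ∧ 1 ∈ S ∧
    ∀ c ∈ S, ∀ d ∈ S, c < d → Ioo c d ∩ S = ∅ → f c = f d}

theorem exists_gap_of_Icc_inter_eq_empty {S : Set ℝ} (hS : IsClosed S) {c d u v : ℝ}
    (hc : c ∈ S) (hd : d ∈ S) (hcu : c ≤ u) (huv : u ≤ v) (hvd : v ≤ d)
    (hK : Icc u v ∩ S = ∅) :
    ∃ c' ∈ S, ∃ d' ∈ S, c ≤ c' ∧ c' < u ∧ v < d' ∧ d' ≤ d ∧ Ioo c' d' ∩ S = ∅ := by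
  obtain ⟨c', ⟨hc'S, hcc', hc'u⟩, hc'⟩ := (isCompact_Icc (a := c) (b := u)).inter_left hS
    |>.exists_isGreatest ⟨c, hc, le_rfl, hcu⟩
  obtain ⟨d', ⟨hd'S, hvd', hd'd⟩, hd'⟩ := (isCompact_Icc (a := v) (b := d)).inter_left hS
    |>.exists_isLeast ⟨d, hd, hvd, le_rfl⟩
  have hno : ∀ z ∈ S, u ≤ z → ¬ z ≤ v := fun z hz h1 h2 =>
    (hK ▸ (⟨⟨h1, h2⟩, hz⟩ : z ∈ Icc u v ∩ S) : z ∈ (∅ : Set ℝ))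
  have hc_lt : c' < u := lt_of_le_of_ne hc'u fun h => hno c' hc'S h.ge (h.le.trans huv)
  have hv_lt : v < d' := lt_of_le_of_ne hvd' fun h => hno d' hd'S (h ▸ huv) h.ge
  refine ⟨c', hc'S, d', hd'S, hcc', hc_lt, hv_lt, hd'd, ?_⟩
  rw [eq_empty_iff_forall_notMem]
  rintro z ⟨⟨h1, h2⟩, hz⟩
  rcases le_or_gt z u with h | h
  · exact h1.not_ge (hc' ⟨hz, hcc'.trans h1.le, h⟩)
  rcases le_or_gt z v with h' | h'
  · exact hno z hz h.le h'
  · exact h2.not_ge (hd' ⟨hz, h'.le, h2.le.trans hd'd⟩)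

theorem exists_minimal_gapClosedSet {X : Type*} [MetricSpace X] {f : ℝ → X} (hf : Continuous f) :
    ∃ S, Minimal (· ∈ gapClosedSets f) S := by
  have hI : Icc (0 : ℝ) 1 ∈ gapClosedSets f := by
    refine ⟨isClosed_Icc, Subset.rfl, by simp, by simp, fun c hc d hd hcd he => ?_⟩
    have : (c + d) / 2 ∈ Ioo c d ∩ Icc 0 1 :=
      ⟨⟨by linarith, by linarith⟩, ⟨by linarith [hc.1, hd.1], by linarith [hc.2, hd.2]⟩⟩
    simp [he] at this
  suffices h : ∀ C ⊆ gapClosedSets f, IsChain (· ⊆ ·) C → C.Nonempty →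
      ∃ lb ∈ gapClosedSets f, ∀ S ∈ C, lb ⊆ S by
    obtain ⟨S, -, hS⟩ := zorn_superset_nonempty (gapClosedSets f) h _ hI
    exact ⟨S, hS⟩
  intro C hC hchain hne
  have hclosed : IsClosed (⋂₀ C) := isClosed_sInter fun S hS => (hC hS).1
  refine ⟨⋂₀ C, ⟨hclosed, ?_, fun S hS => (hC hS).2.2.1, fun S hS => (hC hS).2.2.2.1, ?_⟩,
    fun S hS => sInter_subset_of_mem hS⟩
  · obtain ⟨S, hS⟩ := hne
    exact (sInter_subset_of_mem hS).trans (hC hS).2.1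
  intro c hc d hd hcd hgap
  refine eq_of_forall_dist_le fun ε hε => ?_
  obtain ⟨δ₁, hδ₁, h1⟩ := Metric.continuous_iff.1 hf c (ε / 2) (half_pos hε)
  obtain ⟨δ₂, hδ₂, h2⟩ := Metric.continuous_iff.1 hf d (ε / 2) (half_pos hε)
  obtain ⟨η, hη, hη'⟩ := exists_between (show 0 < min (min δ₁ δ₂) ((d - c) / 2) from
    lt_min (lt_min hδ₁ hδ₂) (by linarith))
  rw [lt_min_iff, lt_min_iff] at hη'
  have : Nonempty C := hne.to_subtype
  obtain ⟨⟨S, hSC⟩, hS⟩ := (isCompact_Icc (a := c + η) (b := d - η)).elim_directed_family_closed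
    (fun S : C => (S : Set ℝ)) (fun S => (hC S.2).1) (by
      rw [← sInter_eq_iInter, eq_empty_iff_forall_notMem]
      rintro z ⟨⟨h1, h2⟩, hz⟩
      exact (hgap ▸ (⟨⟨by linarith, by linarith⟩, hz⟩ : z ∈ Ioo c d ∩ ⋂₀ C) : z ∈ (∅ : Set ℝ)))
    (fun a b => (hchain.total a.2 b.2).elim (fun h => ⟨a, Subset.rfl, h⟩)
      fun h => ⟨b, h, Subset.rfl⟩)
  obtain ⟨c', hc', d', hd', hcc', hc'u, hvd', hd'd, he⟩ := exists_gap_of_Icc_inter_eq_empty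
    (hC hSC).1 (hc S hSC) (hd S hSC) (by linarith) (by linarith) (by linarith) hS
  have heq := (hC hSC).2.2.2.2 c' hc' d' hd' (by linarith) he
  have h3 := h1 c' (by rw [Real.dist_eq, abs_lt]; constructor <;> linarith [hη'.1.1])
  have h4 := h2 d' (by rw [Real.dist_eq, abs_lt]; constructor <;> linarith [hη'.1.2])
  rw [heq, dist_comm] at h3
  linarith [dist_triangle (f c) (f d') (f d)]

theorem Ioo_inter_eq_empty_of_minimal {X : Type*} {f : ℝ → X} {S : Set ℝ}
    (hS : Minimal (· ∈ gapClosedSets f) S) {s t : ℝ} (hs : s ∈ S) (ht : t ∈ S)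
    (hfst : f s = f t) : Ioo s t ∩ S = ∅ := by
  obtain ⟨hcl, hsub, h0, h1, hgap⟩ := hS.prop
  have hmem : S \ Ioo s t ∈ gapClosedSets f := by
    refine ⟨hcl.sdiff isOpen_Ioo, sdiff_subset.trans hsub, ⟨h0, fun h => ?_⟩, ⟨h1, fun h => ?_⟩,
      fun c hc d hd hcd he => ?_⟩
    · exact h.1.not_ge (hsub hs).1
    · exact h.2.not_ge (hsub ht).2
    · by_cases he' : Ioo c d ∩ S = ∅
      · exact hgap c hc.1 d hd.1 hcd he'
      obtain ⟨r, ⟨hcr, hrd⟩, hrS⟩ := nonempty_iff_ne_empty.2 he'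
      have hno : ∀ z ∈ S, z ∉ Ioo s t → c < z → ¬ z < d := fun z hz hz' h1 h2 =>
        (he ▸ (⟨⟨h1, h2⟩, hz, hz'⟩ : z ∈ Ioo c d ∩ (S \ Ioo s t)) : z ∈ (∅ : Set ℝ))
      have hr : r ∈ Ioo s t := by_contra fun h => hno r hrS h hcr hrd
      have hsc : s ≤ c := not_lt.1 fun h => hno s hs (by simp) h (hr.1.trans hrd)
      have hdt : d ≤ t := not_lt.1 fun h => hno t ht (by simp) (hcr.trans hr.2) h
      have hcs : c ≤ s := not_lt.1 fun h => hc.2 ⟨h, hcr.trans hr.2⟩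
      have htd : t ≤ d := not_lt.1 fun h => hd.2 ⟨hr.1.trans hrd, h⟩
      rw [le_antisymm hcs hsc, le_antisymm hdt htd, hfst]
  have hle : S ⊆ S \ Ioo s t := hS.le_of_le hmem sdiff_subset
  rw [eq_empty_iff_forall_notMem]
  exact fun z hz => (hle hz.2).2 hz.1

/-- Collapsing loops: every path can be replaced by one with connected fibres. -/
theorem exists_monotone_path {X : Type*} [MetricSpace X] {f : ℝ → X} (hf : Continuous f) :
    ∃ g : ℝ → X, Continuous g ∧ g 0 = f 0 ∧ g 1 = f 1 ∧ range g ⊆ f '' Icc 0 1 ∧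
      ∀ s r t, 0 ≤ s → t ≤ 1 → s ≤ r → r ≤ t → g s = g t → g r = g s := by
  obtain ⟨S, hS⟩ := exists_minimal_gapClosedSet hf
  obtain ⟨hcl, hsub, h0, h1, hgap⟩ := hS.prop
  have hτ : ∀ t, t ∈ Icc (0 : ℝ) 1 → ∃ u, IsLeast (S ∩ Icc t 1) u := fun t ht =>
    (isCompact_Icc.inter_left hcl).exists_isLeast ⟨1, h1, ht.2, le_rfl⟩
  choose! τ hτ using hτ
  have hτS : ∀ t ∈ Icc (0 : ℝ) 1, τ t ∈ S := fun t ht => (hτ t ht).1.1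
  have hτfix : ∀ t ∈ S, τ t = t := fun t ht => le_antisymm
    ((hτ t (hsub ht)).2 ⟨ht, le_rfl, (hsub ht).2⟩) (hτ t (hsub ht)).1.2.1
  have hτle : ∀ s ∈ Icc (0 : ℝ) 1, ∀ t ∈ S, s ≤ t → τ s ≤ t := fun s hs t ht hst =>
    (hτ s hs).2 ⟨ht, hst, (hsub ht).2⟩
  have hmono : ∀ s ∈ Icc (0 : ℝ) 1, ∀ t ∈ Icc (0 : ℝ) 1, s ≤ t → τ s ≤ τ t := fun s hs t ht hst =>
    hτle s hs _ (hτS t ht) (hst.trans (hτ t ht).1.2.1)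
  have hfib : ∀ s r t, 0 ≤ s → t ≤ 1 → s ≤ r → r ≤ t → f (τ s) = f (τ t) → f (τ r) = f (τ s) := by
    intro s r t hs ht hsr hrt heq
    have hs' : s ∈ Icc (0 : ℝ) 1 := ⟨hs, by linarith⟩
    have hr' : r ∈ Icc (0 : ℝ) 1 := ⟨by linarith, by linarith⟩
    have ht' : t ∈ Icc (0 : ℝ) 1 := ⟨by linarith, ht⟩
    have he := Ioo_inter_eq_empty_of_minimal hS (hτS s hs') (hτS t ht') heq
    rcases (hmono s hs' r hr' hsr).eq_or_lt with h | h
    · rw [h]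
    rcases (hmono r hr' t ht' hrt).eq_or_lt with h' | h'
    · rw [h', heq]
    · have : τ r ∈ Ioo (τ s) (τ t) ∩ S := ⟨⟨h, h'⟩, hτS r hr'⟩
      simp [he] at this
  have hcont : ContinuousOn (fun t => f (τ t)) (Icc 0 1) := by
    rw [Metric.continuousOn_iff]
    intro a ha ε hε
    obtain ⟨δ, hδ, hunif⟩ := Metric.uniformContinuousOn_iff.1
      (isCompact_Icc.uniformContinuousOn_of_continuous hf.continuousOn (s := Icc (0 : ℝ) 1)) ε hε
    have key : ∀ s ∈ Icc (0 : ℝ) 1, ∀ t ∈ Icc (0 : ℝ) 1, s ≤ t → t - s < δ →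
        dist (f (τ s)) (f (τ t)) < ε := by
      intro s hs t ht hst hd
      by_cases he : (S ∩ Icc s t).Nonempty
      · obtain ⟨ρ, ⟨hρS, hρ1, hρ2⟩, hρ⟩ := (isCompact_Icc.inter_left hcl).exists_isGreatest he
        have hfρ : f ρ = f (τ t) := by
          rcases (hρ2.trans (hτ t ht).1.2.1).eq_or_lt with h | h
          · rw [← h]
          refine hgap ρ hρS _ (hτS t ht) h (eq_empty_iff_forall_notMem.2 ?_)
          rintro z ⟨⟨hz1, hz2⟩, hzS⟩
          rcases le_total z t with hzt | hzt
          · exact hz1.not_ge (hρ ⟨hzS, hρ1.trans hz1.le, hzt⟩)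
          · exact hz2.not_ge (hτle t ht z hzS hzt)
        have hτρ := hτle s hs ρ hρS hρ1
        have hsτ := (hτ s hs).1.2.1
        rw [← hfρ]
        refine hunif _ (hsub (hτS s hs)) _ (hsub hρS) ?_
        rw [Real.dist_eq, abs_lt]
        constructor <;> linarith
      · have : τ s = τ t := by
          refine le_antisymm (hmono s hs t ht hst) (hτle t ht _ (hτS s hs) ?_)
          by_contra! h
          exact he ⟨τ s, hτS s hs, (hτ s hs).1.2.1, h.le⟩
        rw [this, dist_self]; exact hε
    refine ⟨δ, hδ, fun b hb hba => ?_⟩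
    rw [Real.dist_eq, abs_lt] at hba
    rcases le_total a b with h | h
    · rw [dist_comm]; exact key a ha b hb h (by linarith)
    · exact key b hb a ha h (by linarith)
  have hproj : ∀ t, t ∈ Icc (0 : ℝ) 1 →
      IccExtend zero_le_one ((Icc (0 : ℝ) 1).domRestrict fun t => f (τ t)) t = f (τ t) :=
    fun t ht => IccExtend_of_mem _ _ ht
  refine ⟨IccExtend zero_le_one ((Icc (0 : ℝ) 1).domRestrict fun t => f (τ t)),
    hcont.domRestrict.Icc_extend', ?_, ?_, ?_, ?_⟩
  · rw [hproj 0 (by simp), hτfix 0 h0]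
  · rw [hproj 1 (by simp), hτfix 1 h1]
  · rw [IccExtend_range]
    rintro _ ⟨t, rfl⟩
    exact ⟨τ t, hsub (hτS t t.2), rfl⟩
  · intro s r t hs ht hsr hrt heq
    rw [hproj s ⟨hs, by linarith⟩, hproj t ⟨by linarith, ht⟩] at heq
    rw [hproj s ⟨hs, by linarith⟩, hproj r ⟨by linarith, by linarith⟩]
    exact hfib s r t hs ht hsr hrt heq

/-- A continuous path with connected fibres factors through a monotone function whose fibres
agree with those of the path. -/
theorem exists_continuous_monotone_fibres {X : Type*} [MetricSpace X] {g : ℝ → X}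
    (hg : Continuous g)
    (hfib : ∀ s r t, 0 ≤ s → t ≤ 1 → s ≤ r → r ≤ t → g s = g t → g r = g s) :
    ∃ φ : ℝ → ℝ, Continuous φ ∧ Monotone φ ∧
      ∀ s ∈ Icc (0 : ℝ) 1, ∀ t ∈ Icc (0 : ℝ) 1, φ s = φ t ↔ g s = g t := by
  let F : ℝ → ℝ → ℝ → ℝ := fun q t r => min 1 (dist (g q) (g (max q (min r t))))
  let ψ : ℝ → ℝ → ℝ := fun q t => sSup (F q t '' Icc 0 1)
  have hne : ∀ q t, (F q t '' Icc 0 1).Nonempty := fun q t => ⟨_, 0, by simp, rfl⟩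
  have hbdd : ∀ q t, BddAbove (F q t '' Icc 0 1) := by
    refine fun q t => ⟨1, ?_⟩
    rintro _ ⟨r, -, rfl⟩
    exact min_le_left _ _
  have hF0 : ∀ q t r, 0 ≤ F q t r := fun q t r => le_min zero_le_one dist_nonneg
  have hψ0 : ∀ q t, 0 ≤ ψ q t := fun q t =>
    (hF0 q t 0).trans (le_csSup (hbdd q t) ⟨0, by simp, rfl⟩)
  have hψ1 : ∀ q t, ψ q t ≤ 1 := by
    refine fun q t => csSup_le (hne q t) ?_
    rintro _ ⟨r, -, rfl⟩
    exact min_le_left _ _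
  have hψc : ∀ q, Continuous (ψ q) := fun q => isCompact_Icc.continuous_sSup (f := F q) (by
    change Continuous fun p : ℝ × ℝ => min 1 (dist (g q) (g (max q (min p.2 p.1))))
    fun_prop)
  have hψm : ∀ q, ∀ s ∈ Icc (0 : ℝ) 1, ∀ t, s ≤ t → ψ q s ≤ ψ q t := by
    intro q s hs t hst
    refine csSup_le (hne q s) ?_
    rintro _ ⟨r, hr, rfl⟩
    refine le_csSup (hbdd q t) ⟨min r s, ⟨le_min hr.1 hs.1, (min_le_left _ _).trans hr.2⟩, ?_⟩
    simp only [F, min_eq_left ((min_le_right r s).trans hst)]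
  let c : ℝ → ℝ := fun t => max 0 (min t 1)
  have hcI : ∀ t, c t ∈ Icc (0 : ℝ) 1 := fun t =>
    ⟨le_max_left _ _, max_le zero_le_one (min_le_right _ _)⟩
  have hcm : Monotone c := fun s t h => max_le_max le_rfl (min_le_min h le_rfl)
  have hcid : ∀ t ∈ Icc (0 : ℝ) 1, c t = t := fun t ht => by
    simp only [c, min_eq_left ht.2, max_eq_right ht.1]
  let D : ℕ → ℝ := TopologicalSpace.denseSeq ℝ
  let a : ℝ → ℕ → ℝ := fun t n => (1 / 2) ^ n * ψ (D n) (c t)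
  have hbound : ∀ t n, ‖a t n‖ ≤ (1 / 2 : ℝ) ^ n := by
    intro t n
    rw [Real.norm_of_nonneg (mul_nonneg (by positivity) (hψ0 _ _))]
    exact mul_le_of_le_one_right (by positivity) (hψ1 _ _)
  have hsum : ∀ t, Summable (a t) := fun t =>
    Summable.of_norm_bounded summable_geometric_two (hbound t)
  have ham : ∀ s t, s ≤ t → a s ≤ a t := fun s t hst n =>
    mul_le_mul_of_nonneg_left (hψm _ _ (hcI s) _ (hcm hst)) (by positivity)
  have key : ∀ s ∈ Icc (0 : ℝ) 1, ∀ t ∈ Icc (0 : ℝ) 1, s ≤ t →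
      (∑' n, a s n = ∑' n, a t n ↔ g s = g t) := by
    intro s hs t ht hst
    constructor
    · intro heq
      by_contra hgst
      have hlt : s < t := lt_of_le_of_ne hst fun h => hgst (h ▸ rfl)
      have hopen : IsOpen (Ioo s t ∩ {q | g q ≠ g t}) :=
        isOpen_Ioo.inter (isOpen_ne_fun hg continuous_const)
      have hnonempty : (Ioo s t ∩ {q | g q ≠ g t}).Nonempty := by
        by_contra hemp
        have hcl : Icc s t ⊆ {q | g q = g t} := by
          rw [← closure_Ioo hlt.ne]
          refine closure_minimal (fun q hq => ?_) (isClosed_eq hg continuous_const)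
          by_contra hq'
          exact hemp ⟨q, hq, hq'⟩
        exact hgst (hcl ⟨le_rfl, hst⟩)
      obtain ⟨n, ⟨hn1, hn2⟩, hn3⟩ :=
        (TopologicalSpace.denseRange_denseSeq ℝ).exists_mem_open hopen hnonempty
      have hs0 : ψ (D n) s = 0 := by
        refine le_antisymm (csSup_le (hne _ _) ?_) (hψ0 _ _)
        rintro _ ⟨r, -, rfl⟩
        have : max (D n) (min r s) = D n := max_eq_left ((min_le_right r s).trans hn1.le)
        simp [F, this]
      have ht0 : 0 < ψ (D n) t := by
        refine lt_of_lt_of_le ?_ (le_csSup (hbdd _ _) ⟨t, ht, rfl⟩)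
        have : max (D n) (min t t) = t := by rw [min_self]; exact max_eq_right hn2.le
        simp only [F, this]
        exact lt_min one_pos (dist_pos.2 hn3)
      refine (Summable.tsum_lt_tsum (i := n) (ham s t hst) ?_ (hsum s) (hsum t)).ne heq
      simp only [a, hcid s hs, hcid t ht, hs0, mul_zero]
      positivity
    · intro heq
      congr 1
      refine le_antisymm (ham s t hst) fun n => ?_
      simp only [a, hcid s hs, hcid t ht]
      refine mul_le_mul_of_nonneg_left (csSup_le (hne _ _) ?_) (by positivity)
      rintro _ ⟨r, hr, rfl⟩
      refine le_csSup (hbdd _ _) ⟨r, hr, ?_⟩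
      have hconst : ∀ z, s ≤ z → z ≤ t → g z = g s := fun z h1 h2 =>
        hfib s z t hs.1 ht.2 h1 h2 heq
      have hgeq : g (max (D n) (min r s)) = g (max (D n) (min r t)) ∨
          max (D n) (min r t) = D n := by
        rcases le_total r s with h | h
        · rw [min_eq_left h, min_eq_left (h.trans hst)]; exact Or.inl rfl
        · rw [min_eq_right h]
          rcases le_total (min r t) (D n) with h' | h'
          · exact Or.inr (max_eq_left h')
          · left
            rw [max_eq_right h', hconst (min r t) (le_min h hst) (min_le_right _ _)]
            exact hconst _ (le_max_right _ _) (max_le (h'.trans (min_le_right _ _)) hst)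
      rcases hgeq with h | h
      · simp only [F, h]
      · have h2 : max (D n) (min r s) = D n :=
          max_eq_left ((min_le_min le_rfl hst).trans (max_eq_left_iff.1 h))
        simp only [F, h, h2]
  refine ⟨fun t => ∑' n, a t n, ?_, ?_, ?_⟩
  · refine continuous_tsum (u := fun n => (1 / 2 : ℝ) ^ n) (fun n => ?_) summable_geometric_two
      fun n t => hbound t n
    exact continuous_const.mul ((hψc (D n)).comp (by fun_prop))
  · exact fun s t hst => (hsum s).tsum_le_tsum (ham s t hst) (hsum t)
  · intro s hs t ht
    rcases le_total s t with h | h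
    · exact key s hs t ht h
    · rw [eq_comm, key t ht s hs h, eq_comm]

/-- `A` is an arc, possibly reduced to a point, with end points `a` and `b`. -/
def IsArcBetween {X : Type*} [TopologicalSpace X] (A : Set X) (a b : X) : Prop :=
  ∃ (γ : ℝ → X) (s t : ℝ), s ≤ t ∧ ContinuousOn γ (Icc s t) ∧ InjOn γ (Icc s t) ∧
    γ s = a ∧ γ t = b ∧ γ '' Icc s t = A

/-- The image of a path contains an arc between the end points of the path. -/
theorem exists_isArcBetween_subset_image {X : Type*} [MetricSpace X] {f : ℝ → X}
    (hf : Continuous f) : ∃ A ⊆ f '' Icc 0 1, IsArcBetween A (f 0) (f 1) := by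
  obtain ⟨g, hg, hg0, hg1, hrange, hfib⟩ := exists_monotone_path hf
  obtain ⟨φ, hφ, hφm, hφg⟩ := exists_continuous_monotone_fibres hg hfib
  have himage : φ '' Icc 0 1 = Icc (φ 0) (φ 1) := by
    refine Subset.antisymm ?_ (intermediate_value_Icc zero_le_one hφ.continuousOn)
    rintro _ ⟨t, ht, rfl⟩
    exact ⟨hφm ht.1, hφm ht.2⟩
  have hsec : ∀ u ∈ Icc (φ 0) (φ 1), ∃ t ∈ Icc (0 : ℝ) 1, φ t = u := fun u hu => by
    rwa [← himage] at hu
  choose! θ hθI hθ using hsec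
  have hmaps : ∀ t ∈ Icc (0 : ℝ) 1, φ t ∈ Icc (φ 0) (φ 1) := fun t ht => ⟨hφm ht.1, hφm ht.2⟩
  have hgθ : ∀ t ∈ Icc (0 : ℝ) 1, g (θ (φ t)) = g t := fun t ht =>
    (hφg _ (hθI _ (hmaps t ht)) _ ht).1 (hθ _ (hmaps t ht))
  refine ⟨(g ∘ θ) '' Icc (φ 0) (φ 1), ?_, g ∘ θ, φ 0, φ 1, hφm zero_le_one, ?_, ?_, ?_, ?_, rfl⟩
  · rintro _ ⟨u, -, rfl⟩
    exact hrange ⟨_, rfl⟩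
  · rw [continuousOn_iff_isClosed]
    intro F hF
    refine ⟨φ '' (Icc 0 1 ∩ g ⁻¹' F),
      ((isCompact_Icc.inter_right (hF.preimage hg)).image hφ).isClosed, ?_⟩
    ext u
    constructor
    · rintro ⟨hu, hu'⟩
      exact ⟨⟨θ u, ⟨hθI u hu', hu⟩, hθ u hu'⟩, hu'⟩
    · rintro ⟨⟨t, ⟨ht, htF⟩, rfl⟩, hu'⟩
      refine ⟨?_, hu'⟩
      rw [mem_preimage, Function.comp_apply, hgθ t ht]
      exact htF
  · intro u hu v hv huv
    rw [← hθ u hu, ← hθ v hv]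
    exact (hφg _ (hθI u hu) _ (hθI v hv)).2 huv
  · rw [Function.comp_apply, hgθ 0 (by simp), hg0]
  · rw [Function.comp_apply, hgθ 1 (by simp), hg1]

theorem JoinedIn.exists_isArcBetween {X : Type*} [MetricSpace X] {F : Set X} {a b : X}
    (h : JoinedIn F a b) : ∃ A ⊆ F, IsArcBetween A a b := by
  obtain ⟨p, hp⟩ := h
  obtain ⟨A, hA, hAab⟩ := exists_isArcBetween_subset_image p.continuous_extend
  rw [p.extend_zero, p.extend_one] at hAab
  refine ⟨A, hA.trans ?_, hAab⟩
  rintro _ ⟨t, ht, rfl⟩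
  rw [p.extend_apply ht]
  exact hp _

/-! ## Arcs and Jordan curves -/

section Arcs

variable {X : Type*} [TopologicalSpace X] {A B J T : Set X} {a b c p x y : X}

theorem IsArcBetween.right_mem (h : IsArcBetween A a b) : b ∈ A := by
  obtain ⟨γ, s, t, hst, -, -, -, rfl, rfl⟩ := h
  exact ⟨t, ⟨hst, le_rfl⟩, rfl⟩

theorem IsArcBetween.symm (h : IsArcBetween A a b) : IsArcBetween A b a := by
  obtain ⟨γ, s, t, hst, hc, hi, ha, hb, rfl⟩ := h
  have hm : MapsTo (fun u : ℝ => -u) (Icc (-t) (-s)) (Icc s t) := fun u hu =>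
    ⟨by linarith [hu.2], by linarith [hu.1]⟩
  refine ⟨fun u => γ (-u), -t, -s, neg_le_neg hst, hc.comp continuous_neg.continuousOn hm,
    hi.comp neg_injective.injOn hm, by simpa, by simpa, ?_⟩
  have : (fun u => γ (-u)) '' Icc (-t) (-s) = γ '' ((fun u : ℝ => -u) '' Icc (-t) (-s)) := by
    rw [image_image]
  rw [this]
  simp

theorem IsArcBetween.exists_param (h : IsArcBetween A a b) (s' : ℝ) :
    ∃ (γ : ℝ → X) (t : ℝ), s' ≤ t ∧ ContinuousOn γ (Icc s' t) ∧ InjOn γ (Icc s' t) ∧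
      γ s' = a ∧ γ t = b ∧ γ '' Icc s' t = A := by
  obtain ⟨γ, s, t, hst, hc, hi, ha, hb, rfl⟩ := h
  have hm : MapsTo (fun u : ℝ => u + (s - s')) (Icc s' (t - (s - s'))) (Icc s t) := fun u hu =>
    ⟨by linarith [hu.1], by linarith [hu.2]⟩
  refine ⟨fun u => γ (u + (s - s')), t - (s - s'), by linarith,
    hc.comp (by fun_prop) hm, hi.comp (add_left_injective _).injOn hm, by simpa, by simpa, ?_⟩
  have : (fun u => γ (u + (s - s'))) '' Icc s' (t - (s - s')) =
      γ '' ((fun u : ℝ => u + (s - s')) '' Icc s' (t - (s - s'))) := by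
    rw [image_image]
  rw [this, image_add_const_Icc, add_sub_cancel, sub_add_cancel]

theorem exists_concatenation {γ₁ γ₂ : ℝ → X} {s t u : ℝ} (hst : s ≤ t) (htu : t ≤ u)
    (h₁ : ContinuousOn γ₁ (Icc s t)) (h₂ : ContinuousOn γ₂ (Icc t u)) (h : γ₁ t = γ₂ t) :
    ∃ γ : ℝ → X, ContinuousOn γ (Icc s u) ∧ EqOn γ γ₁ (Icc s t) ∧ EqOn γ γ₂ (Icc t u) := by
  have e₁ : EqOn (fun x => if x ≤ t then γ₁ x else γ₂ x) γ₁ (Icc s t) := fun x hx => if_pos hx.2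
  have e₂ : EqOn (fun x => if x ≤ t then γ₁ x else γ₂ x) γ₂ (Icc t u) := by
    intro x hx
    rcases hx.1.eq_or_lt with rfl | hlt
    · simpa using h
    · exact if_neg hlt.not_ge
  refine ⟨fun x => if x ≤ t then γ₁ x else γ₂ x, ?_, e₁, e₂⟩
  rw [← Icc_union_Icc_eq_Icc hst htu]
  exact (h₁.congr e₁).union_of_isClosed (h₂.congr e₂) isClosed_Icc isClosed_Icc

theorem IsArcBetween.trans (hA : IsArcBetween A a b) (hB : IsArcBetween B b c)
    (hAB : A ∩ B ⊆ {b}) : IsArcBetween (A ∪ B) a c := by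
  obtain ⟨γ₁, s, t, hst, hc₁, hi₁, ha, hb, rfl⟩ := hA
  obtain ⟨γ₂, u, htu, hc₂, hi₂, hb', hc, rfl⟩ := hB.exists_param t
  obtain ⟨γ, hγ, e₁, e₂⟩ := exists_concatenation hst htu hc₁ hc₂ (hb.trans hb'.symm)
  have hcross : ∀ v ∈ Icc s t, ∀ w ∈ Icc t u, γ v = γ w → v = w := by
    intro v hv w hw hvw
    rw [e₁ hv, e₂ hw] at hvw
    have hvb : γ₁ v = b := hAB ⟨⟨v, hv, rfl⟩, ⟨w, hw, hvw.symm⟩⟩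
    have h1 : v = t := hi₁ hv ⟨hst, le_rfl⟩ (hvb.trans hb.symm)
    have h2 : w = t := hi₂ hw ⟨le_rfl, htu⟩ ((hvw.symm.trans hvb).trans hb'.symm)
    rw [h1, h2]
  refine ⟨γ, s, u, hst.trans htu, hγ, ?_, ?_, ?_, ?_⟩
  · rw [← Icc_union_Icc_eq_Icc hst htu]
    rintro v (hv | hv) w (hw | hw) hvw
    · exact hi₁ hv hw (by rwa [← e₁ hv, ← e₁ hw])
    · exact hcross v hv w hw hvw
    · exact (hcross w hw v hv hvw.symm).symm
    · exact hi₂ hv hw (by rwa [← e₂ hv, ← e₂ hw])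
  · rw [e₁ ⟨le_rfl, hst⟩, ha]
  · rw [e₂ ⟨htu, le_rfl⟩, hc]
  · rw [← Icc_union_Icc_eq_Icc hst htu, image_union, e₁.image_eq, e₂.image_eq]

/-- The initial part of an arc up to its first point in a closed set. -/
theorem IsArcBetween.exists_first_hit (hA : IsArcBetween A a b) {F : Set X} (hF : IsClosed F)
    (hb : b ∈ F) : ∃ u ∈ F, ∃ A' ⊆ A, IsArcBetween A' a u ∧ A' ∩ F ⊆ {u} := by
  obtain ⟨γ, s, t, hst, hc, hi, ha, rfl, rfl⟩ := hA
  obtain ⟨u, ⟨hu, huF⟩, hleast⟩ := (isCompact_Icc.of_isClosed_subset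
    (hc.preimage_isClosed_of_isClosed isClosed_Icc hF) inter_subset_left).exists_isLeast
      ⟨t, ⟨hst, le_rfl⟩, hb⟩
  have hsub : Icc s u ⊆ Icc s t := Icc_subset_Icc_right hu.2
  refine ⟨γ u, huF, γ '' Icc s u, image_mono hsub,
    ⟨γ, s, u, hu.1, hc.mono hsub, hi.mono hsub, ha, rfl, rfl⟩, ?_⟩
  rintro _ ⟨⟨v, hv, rfl⟩, hvF⟩
  rw [le_antisymm hv.2 (hleast ⟨hsub hv, hvF⟩)]
  rfl

theorem IsArcBetween.exists_mem_of_ne (hA : IsArcBetween A a b) (hab : a ≠ b) :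
    ∃ x ∈ A, x ≠ a ∧ x ≠ b := by
  obtain ⟨γ, s, t, hst, -, hi, rfl, rfl, rfl⟩ := hA
  have hlt : s < t := hst.lt_of_ne fun h => hab (h ▸ rfl)
  have hm : (s + t) / 2 ∈ Icc s t := ⟨by linarith, by linarith⟩
  refine ⟨_, ⟨_, hm, rfl⟩, fun h => ?_, fun h => ?_⟩
  · linarith [hi hm ⟨le_rfl, hst⟩ h]
  · linarith [hi hm ⟨hst, le_rfl⟩ h]

/-- The unit circle in `ℂ` is homeomorphic to the unit circle in the Euclidean plane. -/
noncomputable def circleHomeomorphCircle1 : Circle ≃ₜ ↥Circle1 :=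
  Complex.orthonormalBasisOneI.repr.toHomeomorph.subtype fun z => by
    rw [← SetLike.mem_coe]
    simp [Circle1, Submonoid.unitSphere]

theorem isJordanCurve_of_loop [T2Space X] {h : ℝ → X} {l : ℝ} (hl : 0 < l)
    (hc : ContinuousOn h (Icc 0 l)) (hi : InjOn h (Ico 0 l)) (h0 : h 0 = h l) :
    IsJordanCurve (h '' Icc 0 l) := by
  have : Fact (0 < l) := ⟨hl⟩
  have hcont := AddCircle.liftIco_zero_continuous h0 hc
  have hlift : ∀ u ∈ Ico 0 l, AddCircle.liftIco l 0 h u = h u := fun u hu =>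
    AddCircle.liftIco_coe_apply (by rwa [zero_add])
  have hrep : ∀ z : AddCircle l, ∃ u ∈ Ico 0 l, (u : AddCircle l) = z := fun z => by
    have := (AddCircle.equivIco l 0 z).2
    exact ⟨_, ⟨this.1, this.2.trans_eq (zero_add l)⟩, (AddCircle.equivIco l 0).symm_apply_apply z⟩
  have hinj : Function.Injective (AddCircle.liftIco l 0 h) := by
    intro z w hzw
    obtain ⟨u, hu, rfl⟩ := hrep z
    obtain ⟨v, hv, rfl⟩ := hrep w
    rw [hlift u hu, hlift v hv] at hzw
    rw [hi hu hv hzw]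
  have hrange : range (AddCircle.liftIco l 0 h) = h '' Icc 0 l := by
    ext x
    constructor
    · rintro ⟨z, rfl⟩
      obtain ⟨u, hu, rfl⟩ := hrep z
      exact ⟨u, Ico_subset_Icc_self hu, (hlift u hu).symm⟩
    · rintro ⟨u, hu, rfl⟩
      rcases hu.2.eq_or_lt with rfl | hlt
      · exact ⟨_, (hlift 0 ⟨le_rfl, hl⟩).trans h0⟩
      · exact ⟨_, hlift u ⟨hu.1, hlt⟩⟩
  rw [← hrange]
  exact ⟨(hcont.isClosedEmbedding hinj).isEmbedding.toHomeomorph.symm.trans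
    ((AddCircle.homeomorphCircle hl.ne').trans circleHomeomorphCircle1)⟩

theorem IsJordanCurve.exists_loop (hJ : IsJordanCurve J) (ha : a ∈ J) :
    ∃ h : ℝ → X, Continuous h ∧ InjOn h (Ico 0 1) ∧ h 0 = a ∧ h 1 = a ∧ h '' Icc 0 1 = J := by
  obtain ⟨e⟩ := hJ
  have : Fact ((0 : ℝ) < 1) := ⟨one_pos⟩
  let e' : AddCircle (1 : ℝ) ≃ₜ J :=
    ((AddCircle.homeomorphCircle one_ne_zero).trans circleHomeomorphCircle1).trans e.symm
  let k : ℝ → X := fun u => e' (e'.symm ⟨a, ha⟩ + (u : AddCircle (1 : ℝ)))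
  refine ⟨k, ?_, ?_, ?_, ?_, ?_⟩
  · exact continuous_subtype_val.comp (e'.continuous.comp
      (continuous_const.add (AddCircle.continuous_mk' 1)))
  · intro u hu v hv huv
    exact (AddCircle.coe_eq_coe_iff_of_mem_Ico (p := (1 : ℝ)) (a := 0) (by rwa [zero_add])
      (by rwa [zero_add])).1 (add_left_cancel (e'.injective (Subtype.val_injective huv)))
  · simp [k]
  · simp [k, AddCircle.coe_period]
  · refine Subset.antisymm ?_ fun x hx => ?_
    · rintro _ ⟨u, -, rfl⟩
      exact Subtype.prop _
    · have hmem := (AddCircle.equivIco (1 : ℝ) 0 (e'.symm ⟨x, hx⟩ - e'.symm ⟨a, ha⟩)).2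
      have hval := (AddCircle.equivIco (1 : ℝ) 0).symm_apply_apply
        (e'.symm ⟨x, hx⟩ - e'.symm ⟨a, ha⟩)
      refine ⟨_, ⟨hmem.1, (hmem.2.trans_eq (zero_add 1)).le⟩, ?_⟩
      change ((e' (_ + (AddCircle.equivIco (1 : ℝ) 0).symm _) : J) : X) = x
      rw [hval, add_sub_cancel, e'.apply_symm_apply]

theorem IsJordanCurve.isClosed [T2Space X] (hJ : IsJordanCurve J) : IsClosed J := by
  obtain ⟨e⟩ := hJ
  have : CompactSpace ↥Circle1 := isCompact_iff_compactSpace.1 (isCompact_sphere _ _)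
  have : CompactSpace J := e.symm.compactSpace
  exact (isCompact_iff_compactSpace.2 this).isClosed

theorem IsArcBetween.isJordanCurve_union [T2Space X] (hA : IsArcBetween A a b)
    (hB : IsArcBetween B b a) (hab : a ≠ b) (hAB : A ∩ B ⊆ {a, b}) : IsJordanCurve (A ∪ B) := by
  obtain ⟨γ₁, t, hst, hc₁, hi₁, ha, hb, rfl⟩ := hA.exists_param 0
  obtain ⟨γ₂, u, htu, hc₂, hi₂, hb', ha', rfl⟩ := hB.exists_param t
  have ht : 0 < t := hst.lt_of_ne fun h => hab (by rw [← ha, ← hb, h])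
  obtain ⟨γ, hγ, e₁, e₂⟩ := exists_concatenation hst htu hc₁ hc₂ (hb.trans hb'.symm)
  have hcross : ∀ v ∈ Icc 0 t, ∀ w ∈ Ico t u, γ v = γ w → v = w := by
    intro v hv w hw hvw
    have hw' := Ico_subset_Icc_self hw
    rw [e₁ hv, e₂ hw'] at hvw
    rcases hAB ⟨⟨v, hv, rfl⟩, ⟨w, hw', hvw.symm⟩⟩ with hva | hvb
    · have : w = u := hi₂ hw' ⟨htu, le_rfl⟩ ((hvw.symm.trans hva).trans ha'.symm)
      exact absurd this hw.2.ne
    · have h1 : v = t := hi₁ hv ⟨hst, le_rfl⟩ (Eq.trans hvb hb.symm)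
      have h2 : w = t := hi₂ hw' ⟨le_rfl, htu⟩ ((hvw.symm.trans hvb).trans hb'.symm)
      rw [h1, h2]
  have himage : γ '' Icc 0 u = γ₁ '' Icc 0 t ∪ γ₂ '' Icc t u := by
    rw [← Icc_union_Icc_eq_Icc hst htu, image_union, e₁.image_eq, e₂.image_eq]
  rw [← himage]
  refine isJordanCurve_of_loop (ht.trans_le htu) hγ ?_ ?_
  · have hsplit : Ico 0 u ⊆ Icc 0 t ∪ Ico t u := fun v hv =>
      (le_total v t).imp (fun h => ⟨hv.1, h⟩) fun h => ⟨h, hv.2⟩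
    intro v hv w hw hvw
    rcases hsplit hv with hv' | hv' <;> rcases hsplit hw with hw' | hw'
    · exact hi₁ hv' hw' (by rwa [← e₁ hv', ← e₁ hw'])
    · exact hcross v hv' w hw' hvw
    · exact (hcross w hw' v hv' hvw.symm).symm
    · have hv'' := Ico_subset_Icc_self hv'
      have hw'' := Ico_subset_Icc_self hw'
      exact hi₂ hv'' hw'' (by rwa [← e₂ hv'', ← e₂ hw''])
  · rw [e₁ ⟨le_rfl, hst⟩, e₂ ⟨htu, le_rfl⟩, ha, ha']

theorem IsJordanCurve.exists_arcs (hJ : IsJordanCurve J) (ha : a ∈ J) (hb : b ∈ J)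
    (hab : a ≠ b) : ∃ A₁ A₂, IsArcBetween A₁ a b ∧ IsArcBetween A₂ a b ∧ A₁ ∪ A₂ = J ∧
      A₁ ∩ A₂ ⊆ {a, b} := by
  obtain ⟨h, hc, hi, h0, h1, rfl⟩ := hJ.exists_loop ha
  obtain ⟨m, hm, rfl⟩ := hb
  have hm0 : 0 < m := hm.1.lt_of_ne fun h => hab (by rw [← h0, h])
  have hm1 : m < 1 := hm.2.lt_of_ne fun h => hab (by rw [← h1, h])
  have hend : ∀ v ∈ Icc m 1, h v = a → v = 1 := by
    intro v hv hva
    by_contra hne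
    have : v = 0 := hi ⟨hm.1.trans hv.1, hv.2.lt_of_ne hne⟩ (by simp) (hva.trans h0.symm)
    linarith [hv.1]
  refine ⟨h '' Icc 0 m, h '' Icc m 1,
    ⟨h, 0, m, hm.1, hc.continuousOn, hi.mono (Icc_subset_Ico_right hm1), h0, rfl, rfl⟩,
    IsArcBetween.symm ⟨h, m, 1, hm.2, hc.continuousOn, ?_, rfl, h1, rfl⟩, ?_, ?_⟩
  · intro v hv w hw hvw
    by_cases hva : h v = a
    · rw [hend v hv hva, hend w hw (hvw ▸ hva)]
    · have hwa : h w ≠ a := hvw ▸ hva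
      exact hi ⟨hm.1.trans hv.1, hv.2.lt_of_ne fun e => hva (e ▸ h1)⟩
        ⟨hm.1.trans hw.1, hw.2.lt_of_ne fun e => hwa (e ▸ h1)⟩ hvw
  · rw [← image_union, Icc_union_Icc_eq_Icc hm.1 hm.2]
  · rintro _ ⟨⟨v, hv, rfl⟩, ⟨w, hw, hwv⟩⟩
    by_cases hva : h v = a
    · exact Or.inl hva
    · have : w = v := hi ⟨hm.1.trans hw.1, hw.2.lt_of_ne fun e => hva (hwv ▸ e ▸ h1)⟩
        ⟨hv.1, hv.2.trans_lt hm1⟩ hwv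
      right
      rw [mem_singleton_iff, le_antisymm hv.2 (this ▸ hw.1)]

theorem isArcBetween_singleton (a : X) : IsArcBetween {a} a a :=
  ⟨fun _ => a, 0, 0, le_rfl, continuousOn_const, by simp, rfl, rfl, by simp⟩

theorem CycliclyConnected.exists_isArcBetween_mem [T2Space X] (hT : CycliclyConnected T)
    (ha : a ∈ T) (hb : b ∈ T) (hy : y ∈ T) (hab : a ≠ b) :
    ∃ A ⊆ T, IsArcBetween A a b ∧ y ∈ A := by
  obtain ⟨J, hJT, hJ, haJ, hyJ, hbJ⟩ :
      ∃ J ⊆ T, IsJordanCurve J ∧ a ∈ J ∧ y ∈ J ∧ (a = y → b ∈ J) := by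
    by_cases hay : a = y
    · obtain ⟨J, h1, h2, h3, h4⟩ := hT a ha b hb hab
      exact ⟨J, h1, h2, h3, hay ▸ h3, fun _ => h4⟩
    · obtain ⟨J, h1, h2, h3, h4⟩ := hT a ha y hy hay
      exact ⟨J, h1, h2, h3, h4, fun h => absurd h hay⟩
  obtain ⟨B, hBT, z, hzJ, hB, haB⟩ : ∃ B ⊆ T, ∃ z ∈ J, IsArcBetween B b z ∧ a ∉ B := by
    by_cases hb' : b ∈ J
    · exact ⟨{b}, singleton_subset_iff.2 hb, b, hb', isArcBetween_singleton b, hab⟩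
    have hay : a ≠ y := fun h => hb' (hbJ h)
    have hby : b ≠ y := fun h => hb' (h ▸ hyJ)
    obtain ⟨J', hJ'T, hJ', hbJ', hyJ'⟩ := hT b hb y hy hby
    obtain ⟨A₁, A₂, hA₁, hA₂, rfl, hinter⟩ := hJ'.exists_arcs hbJ' hyJ' hby
    by_cases h : a ∈ A₁
    · refine ⟨A₂, subset_union_right.trans hJ'T, y, hyJ, hA₂, fun h' => ?_⟩
      rcases hinter ⟨h, h'⟩ with h | h
      exacts [hab h, hay h]
    · exact ⟨A₁, subset_union_left.trans hJ'T, y, hyJ, hA₁, h⟩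
  obtain ⟨u, huJ, B', hB'B, hB', hB'J⟩ := hB.exists_first_hit hJ.isClosed hzJ
  have hau : a ≠ u := fun h => haB (hB'B (h ▸ hB'.right_mem))
  obtain ⟨C, hCJ, hC, hyC⟩ : ∃ C ⊆ J, IsArcBetween C a u ∧ y ∈ C := by
    obtain ⟨A₁, A₂, hA₁, hA₂, rfl, -⟩ := hJ.exists_arcs haJ huJ hau
    rcases hyJ with h | h
    exacts [⟨A₁, subset_union_left, hA₁, h⟩, ⟨A₂, subset_union_right, hA₂, h⟩]
  exact ⟨C ∪ B', union_subset (hCJ.trans hJT) (hB'B.trans hBT),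
    hC.trans hB'.symm fun v hv => hB'J ⟨hv.2, hCJ hv.1⟩, Or.inl hyC⟩

/-- Attaching an arc to a cyclicly connected set along two distinct points. -/
theorem CycliclyConnected.union_arc [T2Space X] (hT : CycliclyConnected T)
    (hA : IsArcBetween A a b) (hab : a ≠ b) (ha : a ∈ T) (hb : b ∈ T) (hAT : A ∩ T ⊆ {a, b}) :
    CycliclyConnected (T ∪ A) := by
  have key : ∀ y ∈ T, ∃ J ⊆ T ∪ A, IsJordanCurve J ∧ A ⊆ J ∧ y ∈ J := by
    intro y hy
    obtain ⟨C, hCT, hC, hyC⟩ := hT.exists_isArcBetween_mem ha hb hy hab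
    refine ⟨A ∪ C, union_subset subset_union_right (hCT.trans subset_union_left),
      hA.isJordanCurve_union hC.symm hab fun v hv => hAT ⟨hv.1, hCT hv.2⟩,
      subset_union_left, Or.inr hyC⟩
  rintro x (hx | hx) y (hy | hy) hxy
  · obtain ⟨J, h1, h2⟩ := hT x hx y hy hxy
    exact ⟨J, h1.trans subset_union_left, h2⟩
  · obtain ⟨J, h1, h2, h3, h4⟩ := key x hx
    exact ⟨J, h1, h2, h4, h3 hy⟩
  · obtain ⟨J, h1, h2, h3, h4⟩ := key y hy
    exact ⟨J, h1, h2, h3 hx, h4⟩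
  · obtain ⟨J, h1, h2, h3, -⟩ := key a ha
    exact ⟨J, h1, h2, h3 hx, h3 hy⟩

/-- A maximal cyclic subset admits no arc outside it joining two of its points. -/
theorem IsMaximalCyclic.eq_of_isArcBetween [T2Space X] (hT : IsMaximalCyclic T)
    (hA : IsArcBetween A a b) (ha : a ∈ T) (hb : b ∈ T) (hAT : A ∩ T ⊆ {a, b}) : a = b := by
  by_contra hab
  obtain ⟨x, hxA, hxa, hxb⟩ := hA.exists_mem_of_ne hab
  have heq := hT.2.2 _ (hT.2.1.union_arc hA hab ha hb hAT) subset_union_left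
  have hxT : x ∈ T := heq ▸ Or.inr hxA
  rcases hAT ⟨hxA, hxT⟩ with h | h
  exacts [hxa h, hxb h]

end Arcs

/-! ## Admissible subcontinua -/

section Admissible

variable {X : Type*}

theorem exists_mem_closure_pathComponentIn_compl [TopologicalSpace X]
    [LocallyPathConnectedSpace X] {T C : Set X} {p : X} (hT : IsClosed T) (hC : IsPreconnected C)
    (hpC : p ∈ C) (hpT : p ∉ T) (hTC : (T ∩ C).Nonempty) :
    ∃ w ∈ T ∩ C, w ∈ closure (pathComponentIn Tᶜ p) := by
  have hopen : ∀ x, IsOpen (pathComponentIn Tᶜ x) := fun x => hT.isOpen_compl.pathComponentIn x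
  obtain ⟨v, hvT, hvC⟩ := hTC
  by_contra! hcon
  have hmem : ∀ w ∈ C, w ∈ closure (pathComponentIn Tᶜ p) → w ∈ pathComponentIn Tᶜ p := by
    intro w hwC hw
    have hwT : w ∉ T := fun hwT => hcon w ⟨hwT, hwC⟩ hw
    obtain ⟨z, hzw, hzp⟩ := mem_closure_iff.1 hw _ (hopen w) (mem_pathComponentIn_self hwT)
    exact JoinedIn.trans hzp (JoinedIn.symm hzw)
  obtain ⟨z, -, hz, hz'⟩ := hC _ _ (hopen p) isClosed_closure.isOpen_compl
    (fun w hw => (em (w ∈ closure (pathComponentIn Tᶜ p))).imp (hmem w hw) id)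
    ⟨p, hpC, mem_pathComponentIn_self hpT⟩ ⟨v, hvC, hcon v ⟨hvT, hvC⟩⟩
  exact hz' (subset_closure hz)

/-- A point of a closed set in the closure of a path component of the complement is approximated
by points of the closed set which are accessible from that component. -/
theorem exists_joinedIn_insert_compl [TopologicalSpace X] [LocallyPathConnectedSpace X]
    {T U : Set X} {p w : X} (hT : IsClosed T) (hwT : w ∈ T)
    (hw : w ∈ closure (pathComponentIn Tᶜ p)) (hU : U ∈ 𝓝 w) :
    ∃ a ∈ T ∩ U, JoinedIn (insert a Tᶜ) p a := by
  obtain ⟨V, ⟨hV, hVc⟩, hVU⟩ := (LocallyPathConnectedSpace.path_connected_basis w).mem_iff.1 hU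
  obtain ⟨z, hzV, hzp⟩ := mem_closure_iff_nhds.1 hw V hV
  obtain ⟨γ, hγ⟩ := hVc.joinedIn z hzV w (mem_of_mem_nhds hV)
  obtain ⟨t, ⟨ht, htT⟩, hleast⟩ := (isCompact_Icc.inter_right
    (hT.preimage γ.continuous_extend)).exists_isLeast
      ⟨(1 : ℝ), ⟨zero_le_one, le_rfl⟩, by simpa using hwT⟩
  have haV : γ.extend t ∈ V := by
    rw [γ.extend_apply ht]
    exact hγ _
  refine ⟨γ.extend t, ⟨htT, hVU haV⟩, (JoinedIn.mono hzp (subset_insert _ _)).trans ?_⟩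
  refine JoinedIn.ofLine (f := fun u => γ.extend (u * t)) ?_ (by simp) (by simp) ?_
  · exact (γ.continuous_extend.comp (by fun_prop)).continuousOn
  · rintro _ ⟨u, hu, rfl⟩
    by_cases h : γ.extend (u * t) ∈ T
    · have hut : u * t ≤ t := mul_le_of_le_one_left ht.1 hu.2
      have : u * t = t := le_antisymm hut
        (hleast ⟨⟨mul_nonneg hu.1 ht.1, hut.trans ht.2⟩, h⟩)
      exact Or.inl (by simp only [this])
    · exact Or.inr h

/-- Two connected sets meeting a maximal cyclic subset and having exactly one common point can
only meet inside that subset. -/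
theorem IsMaximalCyclic.mem_of_inter_eq_singleton [MetricSpace X] [LocallyPathConnectedSpace X]
    {T C₁ C₂ : Set X} {p : X} (hT : IsMaximalCyclic T) (hTc : IsClosed T)
    (hC₁ : IsPreconnected C₁) (hC₂ : IsPreconnected C₂) (hp : C₁ ∩ C₂ = {p})
    (h₁ : (T ∩ C₁).Nonempty) (h₂ : (T ∩ C₂).Nonempty) : p ∈ T := by
  by_contra hpT
  have hpC : p ∈ C₁ ∩ C₂ := hp ▸ rfl
  obtain ⟨w₁, hw₁, hcl₁⟩ := exists_mem_closure_pathComponentIn_compl hTc hC₁ hpC.1 hpT h₁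
  obtain ⟨w₂, hw₂, hcl₂⟩ := exists_mem_closure_pathComponentIn_compl hTc hC₂ hpC.2 hpT h₂
  have hne : w₁ ≠ w₂ := by
    rintro rfl
    have : w₁ ∈ C₁ ∩ C₂ := ⟨hw₁.2, hw₂.2⟩
    rw [hp] at this
    exact hpT (this ▸ hw₁.1)
  obtain ⟨U₁, U₂, hU₁, hU₂, hm₁, hm₂, hdisj⟩ := t2_separation hne
  obtain ⟨a, ⟨haT, haU⟩, hpa⟩ := exists_joinedIn_insert_compl hTc hw₁.1 hcl₁ (hU₁.mem_nhds hm₁)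
  obtain ⟨b, ⟨hbT, hbU⟩, hpb⟩ := exists_joinedIn_insert_compl hTc hw₂.1 hcl₂ (hU₂.mem_nhds hm₂)
  have hab : JoinedIn ({a, b} ∪ Tᶜ) a b := by
    refine (hpa.symm.mono ?_).trans (hpb.mono ?_)
    · exact insert_subset (by simp) subset_union_right
    · exact insert_subset (by simp) subset_union_right
  obtain ⟨A, hA, hAab⟩ := hab.exists_isArcBetween
  have : a = b := hT.eq_of_isArcBetween hAab haT hbT fun x hx =>
    (hA hx.1).resolve_right fun h => h hx.2
  exact hdisj.ne_of_mem haU hbU this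

theorem IsBoundaryComponentOf.eq_of_mem [TopologicalSpace X] {T b₁ b₂ : Set X} {p : X}
    (h₁ : IsBoundaryComponentOf T b₁) (h₂ : IsBoundaryComponentOf T b₂) (hp₁ : p ∈ b₁)
    (hp₂ : p ∈ b₂) : b₁ = b₂ := by
  obtain ⟨_, ⟨x, -, rfl⟩, rfl⟩ := h₁
  obtain ⟨_, ⟨y, -, rfl⟩, rfl⟩ := h₂
  obtain ⟨q, hq, rfl⟩ := hp₁
  obtain ⟨q', hq', h⟩ := hp₂
  rw [Subtype.val_injective h] at hq'
  rw [connectedComponentIn_eq hq, connectedComponentIn_eq hq']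

end Admissible

/-! ## STATEMENT 9 -/

theorem stmt9 (X : Type) [MetricSpace X] (hX : IsPeano X)
    (hsurf : ∀ T : Set X, IsMaximalCyclic T → IsCompactSurface ↥T)
    (C₁ C₂ : Set X) (hC₁ : IsAdmissible C₁) (hC₂ : IsAdmissible C₂)
    (hinter : ∃ p : X, C₁ ∩ C₂ = {p}) :
    IsAdmissible (C₁ ∪ C₂) := by
  obtain ⟨p, hp⟩ := hinter
  have hpC : p ∈ C₁ ∩ C₂ := hp ▸ rfl
  obtain ⟨hcompact, -, hlc⟩ := hX
  have := locallyPathConnectedSpace_of_complete X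
  refine ⟨⟨hC₁.1.1.union hC₂.1.1, IsConnected.union ⟨p, hpC⟩ hC₁.1.2 hC₂.1.2⟩, fun T hT => ?_⟩
  have hTc : IsClosed T := by
    have := (hsurf T hT).1
    exact (isCompact_iff_compactSpace.2 this).isClosed
  rw [inter_union_distrib_left]
  rcases (T ∩ C₁).eq_empty_or_nonempty with he₁ | hne₁
  · rw [he₁, empty_union]
    exact hC₂.2 T hT
  rcases (T ∩ C₂).eq_empty_or_nonempty with he₂ | hne₂
  · rw [he₂, union_empty]
    exact hC₁.2 T hT
  have hpT : p ∈ T := hT.mem_of_inter_eq_singleton hTc hC₁.1.2.2 hC₂.1.2.2 hp hne₁ hne₂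
  rcases hC₁.2 T hT with hs₁ | hb₁
  · rw [union_eq_right.2 fun x hx => hs₁ hx ⟨hpT, hpC.1⟩ ▸ ⟨hpT, hpC.2⟩]
    exact hC₂.2 T hT
  rcases hC₂.2 T hT with hs₂ | hb₂
  · rw [union_eq_left.2 fun x hx => hs₂ hx ⟨hpT, hpC.2⟩ ▸ ⟨hpT, hpC.1⟩]
    exact Or.inr hb₁
  · rw [hb₁.eq_of_mem hb₂ ⟨hpT, hpC.1⟩ ⟨hpT, hpC.2⟩, union_self]
    exact Or.inr hb₂
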